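/- Let p be a prime number and let k be a p-adic field, i.e., a field equipped with a ℚ_p-algebra structure making it finite-dimensional over ℚ_p. Let V be a finite-dimensional k-vector space with dim_k V ≥ 3 and let q be a quadratic form on V whose polar bilinear form is nondegenerate. Then for every finite field extension l/k of even degree, the base change of q to l is isotropic: there exists a nonzero vector v ∈ l ⊗_k V with q_l(v) = 0. -/

import Mathlib

open scoped TensorProduct

/-- The base change of a quadratic form over a field of characteristic zero
(here, a `p`-adic field). -/
noncomputable def QuadraticFormPadic.baseChange
    (p : ℕ) [Fact p.Prime] (k : Type) [Field k] [Algebra ℚ_[p] k]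
    (V : Type) [AddCommGroup V] [Module k V]
    (l : Type) [Field l] [Algebra k l]
    (q : QuadraticForm k V) : QuadraticForm l (l ⊗[k] V) :=
  letI : CharZero k := charZero_of_injective_algebraMap (algebraMap ℚ_[p] k).injective
  letI : Invertible (2 : k) := invertibleOfNonzero two_ne_zero
  QuadraticForm.baseChange l q

section FiniteField

open MvPolynomial in
/-- A ternary quadratic form of this shape over a finite field is isotropic (Chevalley). -/
theorem FiniteField.exists_ne_zero_ternary {F : Type*} [Field F] [Finite F] (b c d : F) :
    ∃ x y z : F, (x ≠ 0 ∨ y ≠ 0 ∨ z ≠ 0) ∧ x ^ 2 + b * x * y + c * y ^ 2 + d * z ^ 2 = 0 := by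
  classical
  have := Fintype.ofFinite F
  let f : MvPolynomial (Fin 3) F := X 0 ^ 2 + C b * X 0 * X 1 + C c * X 1 ^ 2 + C d * X 2 ^ 2
  have hf : f.totalDegree < Fintype.card (Fin 3) := by
    have h : ∀ (a : F) (i j : Fin 3),
        (C a * (X i * X j) : MvPolynomial (Fin 3) F).totalDegree ≤ 2 := by
      intro a i j
      refine (totalDegree_mul _ _).trans ?_
      have := totalDegree_mul (X i : MvPolynomial (Fin 3) F) (X j)
      simp only [totalDegree_C, totalDegree_X] at this ⊢
      omega
    have e : f = C 1 * (X 0 * X 0) + C b * (X 0 * X 1) + C c * (X 1 * X 1) + C d * (X 2 * X 2) := by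
      simp only [f, map_one]; ring
    rw [e, Fintype.card_fin, Nat.lt_succ_iff]
    refine (totalDegree_add _ _).trans (max_le ((totalDegree_add _ _).trans
      (max_le ((totalDegree_add _ _).trans (max_le ?_ ?_)) ?_)) ?_) <;> apply h
  have hdvd := char_dvd_card_solutions (ringChar F) hf
  have h0 : eval (0 : Fin 3 → F) f = 0 := by simp [f]
  have hp : 1 < Fintype.card { x : Fin 3 → F // eval x f = 0 } := by
    have : 0 < Fintype.card { x : Fin 3 → F // eval x f = 0 } := Fintype.card_pos_iff.2 ⟨⟨0, h0⟩⟩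
    exact (CharP.char_is_prime F (ringChar F)).one_lt.trans_le (Nat.le_of_dvd this hdvd)
  have := Fintype.one_lt_card_iff_nontrivial.1 hp
  obtain ⟨⟨v, hv⟩, hne⟩ := exists_ne (⟨0, h0⟩ : { x : Fin 3 → F // eval x f = 0 })
  refine ⟨v 0, v 1, v 2, ?_, by simpa [f] using hv⟩
  contrapose! hne
  ext i
  fin_cases i <;> simp [hne]

theorem FiniteField.mem_range_algebraMap_of_pow_card_eq {E Ω : Type*} [Field E] [Fintype E]
    [Field Ω] [Algebra E Ω] {α : Ω} (h : α ^ Fintype.card E = α) : α ∈ (algebraMap E Ω).range := by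
  have hs := (FiniteField.isSplittingField_sub E E).splits
  simp only [Polynomial.map_sub, Polynomial.map_pow, Polynomial.map_X] at hs
  refine hs.mem_range_of_isRoot (FiniteField.X_pow_card_sub_X_ne_zero E Fintype.one_lt_card) ?_
  simp [h]

/-- A monic quadratic polynomial over a finite field has a root in every extension of even
degree. -/
theorem FiniteField.exists_root_quadratic_of_even_finrank {F E : Type*} [Field F] [Field E]
    [Finite E] [Algebra F E] (h : Even (Module.finrank F E)) (b c : F) :
    ∃ t : E, t ^ 2 + algebraMap F E b * t + algebraMap F E c = 0 := by
  have := Fintype.ofFinite E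
  have : Finite F := Finite.of_injective _ (algebraMap F E).injective
  have := Fintype.ofFinite F
  let Ω := AlgebraicClosure E
  let φ := FiniteField.frobeniusAlgHom F Ω
  obtain ⟨α, hα⟩ : ∃ α : Ω, α ^ 2 + algebraMap F Ω b * α + algebraMap F Ω c = 0 := by
    obtain ⟨α, hα⟩ := IsAlgClosed.exists_root (Polynomial.X ^ 2 +
      Polynomial.C (algebraMap F Ω b) * Polynomial.X + Polynomial.C (algebraMap F Ω c)) (by
      have : (Polynomial.X ^ 2 + Polynomial.C (algebraMap F Ω b) * Polynomial.X +
        Polynomial.C (algebraMap F Ω c)).degree = 2 := by compute_degree!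
      exact this ▸ by norm_num)
    exact ⟨α, by simpa using hα⟩
  have h1 : (φ α) ^ 2 + algebraMap F Ω b * φ α + algebraMap F Ω c = 0 := by
    simpa using congrArg φ hα
  have h2 : φ (φ α) = α := by
    have : (φ α - α) * (φ α + algebraMap F Ω b + α) = 0 := by linear_combination h1 - hα
    rcases mul_eq_zero.1 this with h | h
    · rw [sub_eq_zero.1 h, sub_eq_zero.1 h]
    · have : φ α = - algebraMap F Ω b - α := by linear_combination h
      rw [this, map_sub, map_neg, AlgHom.commutes, this]
      ring
  obtain ⟨m, hm⟩ := h
  have h3 : α ^ Fintype.card E = α := by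
    rw [Module.card_eq_pow_finrank (K := F) (V := E), hm, ← two_mul, pow_mul]
    have h2' : α ^ (Fintype.card F ^ 2) = α := by
      rw [sq, pow_mul]; exact h2
    generalize Fintype.card F ^ 2 = N at *
    clear hm
    induction m with
    | zero => simp
    | succ m ih => rw [pow_succ, pow_mul, ih, h2']
  obtain ⟨t, rfl⟩ := FiniteField.mem_range_algebraMap_of_pow_card_eq h3
  refine ⟨t, (algebraMap E Ω).injective ?_⟩
  simpa [← IsScalarTower.algebraMap_apply] using hα

theorem FiniteField.exists_sq_add_eq_zero_of_char_two {F : Type*} [Field F] [Finite F]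
    (h : (2 : F) = 0) (c : F) : ∃ t : F, t ^ 2 + c = 0 := by
  have hr : ringChar F = 2 := by
    have : CharP F 2 := CharTwo.of_one_ne_zero_of_two_eq_zero one_ne_zero h
    exact ringChar.eq F 2 ▸ rfl
  obtain ⟨t, ht⟩ := FiniteField.isSquare_of_char_two hr (-c)
  exact ⟨t, by linear_combination -ht⟩

end FiniteField

section

open scoped NormedField Valued

section

variable {K : Type*} [NontriviallyNormedField K] [IsUltrametricDist K]

instance [ProperSpace K] : CompactSpace 𝒪[K] := by
  have h : ((𝒪[K] : Subring K) : Set K) = Metric.closedBall 0 1 := by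
    ext x; simp [Valued.integer.mem_iff]
  exact isCompact_iff_compactSpace.1 (h ▸ isCompact_closedBall (0 : K) 1)

theorem isDiscreteValuationRing_and_finite_residueField [ProperSpace K] :
    IsDiscreteValuationRing 𝒪[K] ∧ Finite 𝓀[K] := by
  have : (Valued.v : Valuation K NNReal).RankOne :=
    inferInstanceAs (NormedField.valuation (K := K)).RankOne
  exact (Valued.integer.compactSpace_iff_completeSpace_and_isDiscreteValuationRing_and_finite_residueField.1
    (inferInstanceAs (CompactSpace 𝒪[K]))).2

theorem residue_eq_zero_iff_norm_lt_one (x : 𝒪[K]) :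
    IsLocalRing.residue 𝒪[K] x = 0 ↔ ‖(x : K)‖ < 1 := by
  rw [IsLocalRing.residue_eq_zero_iff, IsLocalRing.mem_maximalIdeal, mem_nonunits_iff,
    Valued.integer.isUnit_iff_norm_eq_one]
  exact ⟨fun h => lt_of_le_of_ne (Valued.integer.norm_le_one x) h, fun h => h.ne⟩

variable {L : Type*} [NontriviallyNormedField L] [IsUltrametricDist L] [NormedAlgebra K L]

noncomputable instance : Algebra 𝒪[K] 𝒪[L] := RingHom.toAlgebra <|
    ((algebraMap K L).comp 𝒪[K].subtype).codRestrict 𝒪[L] fun x => by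
      rw [Valued.integer.mem_iff]
      simpa [norm_algebraMap'] using! Valued.integer.norm_le_one x
theorem coe_algebraMap_integer (x : 𝒪[K]) :
    ((algebraMap 𝒪[K] 𝒪[L] x : 𝒪[L]) : L) = algebraMap K L x := rfl
instance : IsScalarTower 𝒪[K] 𝒪[L] L := .of_algebraMap_eq fun _ => rfl

omit [IsUltrametricDist L] in
theorem isIntegral_of_norm_le_one [CompleteSpace K] [Algebra.IsAlgebraic K L] (x : L)
    (hx : ‖x‖ ≤ 1) : IsIntegral 𝒪[K] x := by
  rw [NormedAlgebra.norm_eq_spectralNorm K] at hx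
  have hm := minpoly.monic (Algebra.IsIntegral.isIntegral (R := K) x)
  have h1 := (spectralValue_le_one_iff hm).1 hx
  have h2 : minpoly K x ∈ Polynomial.lifts (algebraMap 𝒪[K] K) := by
    rw [Polynomial.lifts_iff_coeff_lifts]
    intro n
    exact ⟨⟨_, Valued.integer.mem_iff.2 (h1 n)⟩, rfl⟩
  obtain ⟨P, hP, -, hPm⟩ := Polynomial.lifts_and_degree_eq_and_monic h2 hm
  refine ⟨P, hPm, ?_⟩
  rw [IsScalarTower.algebraMap_eq 𝒪[K] K L, ← Polynomial.eval₂_map, hP]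
  exact minpoly.aeval K x

instance [CompleteSpace K] [Algebra.IsAlgebraic K L] : IsIntegralClosure 𝒪[L] 𝒪[K] L where
  algebraMap_injective := Subtype.val_injective
  isIntegral_iff {x} := by
    constructor
    · intro h
      have h := IsIntegral.tower_top (A := 𝒪[L]) h
      rw [IsIntegrallyClosed.isIntegral_iff] at h
      exact h
    · rintro ⟨y, rfl⟩
      exact isIntegral_of_norm_le_one _ (Valued.integer.norm_le_one y)

theorem exists_map_maximalIdeal_eq_pow (R S : Type*) [CommRing R] [IsDomain R]
    [IsDiscreteValuationRing R] [CommRing S] [IsDomain S] [IsDiscreteValuationRing S]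
    [Algebra R S] [Module.Finite R S] [Module.IsTorsionFree R S] [IsLocalHom (algebraMap R S)] :
    ∃ e : ℕ, (IsLocalRing.maximalIdeal R).map (algebraMap R S) = IsLocalRing.maximalIdeal S ^ e ∧
      e * Module.finrank (IsLocalRing.ResidueField R) (IsLocalRing.ResidueField S) =
        Module.finrank R S := by
  set m := IsLocalRing.maximalIdeal R
  set n := IsLocalRing.maximalIdeal S with hn
  have hm : m.map (algebraMap R S) ≠ ⊥ := by
    rw [Ne, Ideal.map_eq_bot_iff_of_injective (FaithfulSMul.algebraMap_injective R S)]
    exact IsDiscreteValuationRing.not_a_field R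
  obtain ⟨e, he⟩ := exists_maximalIdeal_pow_eq_of_principal S (IsPrincipalIdealRing.principal _)
    _ hm
  let : Unique (m.primesOver S) :=
    { default := ⟨n, inferInstance, inferInstance⟩
      uniq := fun q => Subtype.ext <| by
        have := q.2.1
        have := q.2.2
        have : q.1.IsMaximal := Ideal.IsMaximal.of_liesOver_isMaximal q.1 m
        exact IsLocalRing.eq_maximalIdeal this }
  refine ⟨e, he, ?_⟩
  have h := Ideal.sum_ramification_inertia_eq_finrank m S
  rw [Fintype.sum_unique] at h
  rw [← h]
  change _ = n.ramificationIdx R * n.inertiaDeg R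
  rw [Ideal.inertiaDeg_eq_of_isMaximal m n, ← Ideal.ramificationIdx'_eq_ramificationIdx' m n hm,
    Ideal.ramificationIdx'_spec he.le]
  · rfl
  · rw [he]
    exact (Ideal.pow_succ_lt_pow (IsDiscreteValuationRing.not_a_field S) e).not_ge

theorem norm_eq_zpow {π : 𝒪[K]} [IsDiscreteValuationRing 𝒪[K]] (hπ : Irreducible π)
    {c : K} (hc : c ≠ 0) : ∃ m : ℤ, ‖c‖ = ‖(π : K)‖ ^ m := by
  have key : ∀ x : K, x ≠ 0 → ‖x‖ ≤ 1 → ∃ m : ℕ, ‖x‖ = ‖(π : K)‖ ^ m := by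
    intro x hx hx1
    obtain ⟨m, u, hu⟩ := IsDiscreteValuationRing.eq_unit_mul_pow_irreducible
      (x := (⟨x, Valued.integer.mem_iff.2 hx1⟩ : 𝒪[K])) (by simpa [Subtype.ext_iff] using hx) hπ
    refine ⟨m, ?_⟩
    have := congrArg (fun y : 𝒪[K] => ‖(y : K)‖) hu
    simpa using this
  rcases le_total ‖c‖ 1 with h | h
  · obtain ⟨m, hm⟩ := key c hc h
    exact ⟨m, by simpa using hm⟩
  · obtain ⟨m, hm⟩ := key c⁻¹ (inv_ne_zero hc) (by simpa using inv_le_one_of_one_le₀ h)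
    refine ⟨-m, ?_⟩
    rw [zpow_neg, zpow_natCast, ← hm, norm_inv, inv_inv]

instance : IsLocalHom (algebraMap 𝒪[K] 𝒪[L]) where
  map_nonunit a ha := by
    rw [Valued.integer.isUnit_iff_norm_eq_one] at ha ⊢
    rw [← ha]
    exact (norm_algebraMap' L (a : K)).symm

/-- The fundamental identity `e * f = n` for an extension of local fields, together with the
effect of the ramification index `e` on the value group. -/
theorem exists_ramificationIdx_mul_finrank_eq [ProperSpace K] [ProperSpace L] [CharZero K]
    [FiniteDimensional K L] :
    ∃ e : ℕ, e * Module.finrank 𝓀[K] 𝓀[L] = Module.finrank K L ∧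
     ∃ π : L, ∀ c : K, c ≠ 0 → ∃ m : ℤ, ‖c‖ = ‖π‖ ^ (e * m) := by
  have := (isDiscreteValuationRing_and_finite_residueField (K := K)).1
  have := (isDiscreteValuationRing_and_finite_residueField (K := L)).1
  have : Module.Finite 𝒪[K] 𝒪[L] := IsIntegralClosure.finite 𝒪[K] K L 𝒪[L]
  have : FaithfulSMul 𝒪[K] 𝒪[L] := by
    rw [faithfulSMul_iff_algebraMap_injective]
    intro x y h
    exact Subtype.ext ((algebraMap K L).injective (congrArg Subtype.val h))
  have : Module.IsTorsionFree 𝒪[K] 𝒪[L] := inferInstance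
  obtain ⟨e, he, hef⟩ := exists_map_maximalIdeal_eq_pow 𝒪[K] 𝒪[L]
  obtain ⟨π, hπ⟩ := IsDiscreteValuationRing.exists_irreducible 𝒪[K]
  obtain ⟨ϖ, hϖ⟩ := IsDiscreteValuationRing.exists_irreducible 𝒪[L]
  refine ⟨e, by rw [hef, IsFractionRing.finrank_eq 𝒪[K] K 𝒪[L] L], ϖ, fun c hc => ?_⟩
  obtain ⟨m, hm⟩ := norm_eq_zpow hπ hc
  refine ⟨m, ?_⟩
  rw [hm, zpow_mul]
  congr 1
  rw [hπ.maximalIdeal_eq, hϖ.maximalIdeal_eq, Ideal.map_span, Set.image_singleton,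
    Ideal.span_singleton_pow, Ideal.span_singleton_eq_span_singleton] at he
  obtain ⟨u, hu⟩ := he
  have := congrArg (fun y : 𝒪[L] => ‖(y : L)‖) hu
  simpa [coe_algebraMap_integer, norm_algebraMap'] using this

end

section

variable {K : Type*} [NontriviallyNormedField K] [IsUltrametricDist K]

theorem norm_add_le_of_norm_le {x y : K} {r : ℝ} (hx : ‖x‖ ≤ r) (hy : ‖y‖ ≤ r) : ‖x + y‖ ≤ r :=
  (IsUltrametricDist.norm_add_le_max x y).trans (max_le hx hy)

theorem norm_add_lt_of_norm_lt {x y : K} {r : ℝ} (hx : ‖x‖ < r) (hy : ‖y‖ < r) : ‖x + y‖ < r :=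
  (IsUltrametricDist.norm_add_le_max x y).trans_lt (max_lt hx hy)

theorem norm_sub_le_of_norm_le {x y : K} {r : ℝ} (hx : ‖x‖ ≤ r) (hy : ‖y‖ ≤ r) : ‖x - y‖ ≤ r := by
  rw [sub_eq_add_neg]; exact norm_add_le_of_norm_le hx (by rwa [norm_neg])

theorem norm_sub_lt_of_norm_lt {x y : K} {r : ℝ} (hx : ‖x‖ < r) (hy : ‖y‖ < r) : ‖x - y‖ < r := by
  rw [sub_eq_add_neg]; exact norm_add_lt_of_norm_lt hx (by rwa [norm_neg])

omit [IsUltrametricDist K] in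
theorem norm_mul_le_one_of_le_of_le {x y : K} (hx : ‖x‖ ≤ 1) (hy : ‖y‖ ≤ 1) : ‖x * y‖ ≤ 1 := by
  rw [norm_mul]; exact mul_le_one₀ hx (norm_nonneg _) hy

omit [IsUltrametricDist K] in
theorem norm_mul_lt_one_of_le_of_lt {x y : K} (hx : ‖x‖ ≤ 1) (hy : ‖y‖ < 1) : ‖x * y‖ < 1 := by
  rw [norm_mul]; exact mul_lt_one_of_nonneg_of_lt_one_right hx (norm_nonneg _) hy

theorem norm_two_le_one : ‖(2 : K)‖ ≤ 1 := by
  simpa using IsUltrametricDist.norm_natCast_le_one K 2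

/-- Hensel lifting for the polynomial `X ^ 2 + X + c`. -/
theorem exists_sq_add_self_add_eq_zero [ProperSpace K] {c : K} (hc : ‖c‖ < 1) :
    ∃ s : K, s ^ 2 + s + c = 0 := by
  obtain ⟨s, hs, hmin⟩ := (isCompact_closedBall (0 : K) ‖c‖).exists_isMinOn
    ⟨0, by simp⟩ (f := fun s => ‖s ^ 2 + s + c‖) (by fun_prop)
  rw [mem_closedBall_zero_iff] at hs
  refine ⟨s, by_contra fun hne => ?_⟩
  set g := s ^ 2 + s + c with hg
  have hgc : ‖g‖ ≤ ‖c‖ := by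
    refine norm_add_le_of_norm_le (norm_add_le_of_norm_le ?_ hs) le_rfl
    rw [sq, norm_mul]
    exact (mul_le_of_le_one_left (norm_nonneg _) (hs.trans hc.le)).trans hs
  have h := isMinOn_iff.1 hmin (s - g) (mem_closedBall_zero_iff.2 (norm_sub_le_of_norm_le hs hgc))
  have e : (s - g) ^ 2 + (s - g) + c = g * (g - 2 * s) := by rw [hg]; ring
  simp only [e, norm_mul] at h
  have h2 : ‖g - 2 * s‖ < 1 :=
    norm_sub_lt_of_norm_lt (hgc.trans_lt hc)
      (norm_mul_lt_one_of_le_of_lt norm_two_le_one (hs.trans_lt hc))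
  exact absurd h (not_le.2 (mul_lt_of_lt_one_right (norm_pos_iff.2 hne) h2))

theorem exists_quadratic_eq_zero_of_norm_lt [ProperSpace K] {a b c : K}
    (h : ‖a‖ * ‖c‖ < ‖b‖ ^ 2) : ∃ t : K, a * t ^ 2 + b * t + c = 0 := by
  have hb : b ≠ 0 := by
    rintro rfl
    simp only [norm_zero, ne_eq, OfNat.ofNat_ne_zero, not_false_eq_true, zero_pow] at h
    exact h.not_ge (by positivity)
  by_cases ha : a = 0
  · exact ⟨-c / b, by rw [ha]; field_simp; ring⟩
  obtain ⟨s, hs⟩ := exists_sq_add_self_add_eq_zero (c := a * c / b ^ 2) (by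
    rw [norm_div, norm_mul, norm_pow]
    exact (div_lt_one (by positivity)).2 h)
  refine ⟨b / a * s, ?_⟩
  have : a * (b / a * s) ^ 2 + b * (b / a * s) + c = b ^ 2 / a * (s ^ 2 + s + a * c / b ^ 2) := by
    field_simp
  rw [this, hs, mul_zero]

theorem exists_ternary_eq_zero_of_norm_lt_one [ProperSpace K] {β γ δ s t w : K}
    (hβ : ‖β‖ ≤ 1) (hγ : ‖γ‖ ≤ 1) (hD : ‖β ^ 2 - 4 * γ‖ = 1)
    (hs : ‖s‖ ≤ 1) (ht : ‖t‖ ≤ 1) (hst : ‖s‖ = 1 ∨ ‖t‖ = 1)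
    (h : ‖s ^ 2 + β * s * t + γ * t ^ 2 + δ * w ^ 2‖ < 1) :
    ∃ x y z : K, (x ≠ 0 ∨ y ≠ 0 ∨ z ≠ 0) ∧ x ^ 2 + β * x * y + γ * y ^ 2 + δ * z ^ 2 = 0 := by
  set f := s ^ 2 + β * s * t + γ * t ^ 2 + δ * w ^ 2 with hf
  have h2 : ‖(2 : K)‖ ≤ 1 := norm_two_le_one
  have hd : 1 ≤ ‖2 * s + β * t‖ ∨ 1 ≤ ‖β * s + 2 * γ * t‖ := by
    by_contra! hlt
    have h1 : ‖(β ^ 2 - 4 * γ) * t‖ < 1 := by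
      rw [show (β ^ 2 - 4 * γ) * t = β * (2 * s + β * t) - 2 * (β * s + 2 * γ * t) by ring]
      exact norm_sub_lt_of_norm_lt (norm_mul_lt_one_of_le_of_lt hβ hlt.1)
        (norm_mul_lt_one_of_le_of_lt h2 hlt.2)
    have h3 : ‖(β ^ 2 - 4 * γ) * s‖ < 1 := by
      rw [show (β ^ 2 - 4 * γ) * s = β * (β * s + 2 * γ * t) - 2 * γ * (2 * s + β * t) by ring]
      exact norm_sub_lt_of_norm_lt (norm_mul_lt_one_of_le_of_lt hβ hlt.2)
        (norm_mul_lt_one_of_le_of_lt (norm_mul_le_one_of_le_of_le h2 hγ) hlt.1)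
    rw [norm_mul, hD, one_mul] at h1 h3
    exact hst.elim h3.ne h1.ne
  rcases hd with hd | hd
  · obtain ⟨r, hr⟩ := exists_quadratic_eq_zero_of_norm_lt (a := 1) (b := 2 * s + β * t) (c := f)
      (by simpa using h.trans_le (one_le_pow₀ hd))
    refine ⟨s + r, t, w, ?_, by rw [← hr, hf]; ring⟩
    by_contra! h0
    obtain ⟨-, rfl, rfl⟩ := h0
    simp only [norm_zero, zero_ne_one, or_false] at hst
    simp [hf, hst] at h
  · obtain ⟨r, hr⟩ := exists_quadratic_eq_zero_of_norm_lt (a := γ) (b := β * s + 2 * γ * t) (c := f)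
      ((mul_le_of_le_one_left (norm_nonneg _) hγ).trans_lt (h.trans_le (one_le_pow₀ hd)))
    refine ⟨s, t + r, w, ?_, by rw [← hr, hf]; ring⟩
    by_contra! h0
    obtain ⟨rfl, -, rfl⟩ := h0
    simp only [norm_zero, zero_ne_one, false_or] at hst
    simp only [ne_eq, OfNat.ofNat_ne_zero, not_false_eq_true, zero_pow, mul_zero, zero_mul,
      zero_add, add_zero, norm_mul, hst, mul_one] at hf hd
    rw [hf, norm_mul, norm_pow, hst, one_pow, mul_one] at h
    exact absurd (mul_lt_one_of_nonneg_of_lt_one_right h2 (norm_nonneg _) h) (not_lt.2 hd)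

theorem norm_eq_one_iff_residue (x : 𝒪[K]) : ‖(x : K)‖ = 1 ↔ IsLocalRing.residue 𝒪[K] x ≠ 0 := by
  rw [Ne, residue_eq_zero_iff_norm_lt_one, not_lt]
  exact ⟨fun h => h.ge, fun h => le_antisymm (Valued.integer.norm_le_one x) h⟩

theorem exists_ternary_eq_zero_of_norm_eq_one [ProperSpace K] {β γ δ : K}
    (hβ : ‖β‖ ≤ 1) (hγ : ‖γ‖ ≤ 1) (hδ : ‖δ‖ = 1) (hD : ‖β ^ 2 - 4 * γ‖ = 1) :
    ∃ x y z : K, (x ≠ 0 ∨ y ≠ 0 ∨ z ≠ 0) ∧ x ^ 2 + β * x * y + γ * y ^ 2 + δ * z ^ 2 = 0 := by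
  have := (isDiscreteValuationRing_and_finite_residueField (K := K)).2
  lift β to 𝒪[K] using Valued.integer.mem_iff.2 hβ
  lift γ to 𝒪[K] using Valued.integer.mem_iff.2 hγ
  lift δ to 𝒪[K] using Valued.integer.mem_iff.2 hδ.le
  obtain ⟨s, t, w, h0, h⟩ := FiniteField.exists_ne_zero_ternary (IsLocalRing.residue 𝒪[K] β)
    (IsLocalRing.residue 𝒪[K] γ) (IsLocalRing.residue 𝒪[K] δ)
  obtain ⟨s, rfl⟩ := IsLocalRing.residue_surjective s
  obtain ⟨t, rfl⟩ := IsLocalRing.residue_surjective t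
  obtain ⟨w, rfl⟩ := IsLocalRing.residue_surjective w
  refine exists_ternary_eq_zero_of_norm_lt_one (s := s) (t := t) (w := w) hβ hγ hD
    (Valued.integer.norm_le_one s) (Valued.integer.norm_le_one t) ?_ ?_
  · rw [norm_eq_one_iff_residue] at hδ
    rw [norm_eq_one_iff_residue, norm_eq_one_iff_residue]
    by_contra! hst
    simp [hst, hδ] at h
    simp [hst, h] at h0
  · exact (residue_eq_zero_iff_norm_lt_one (s ^ 2 + β * s * t + γ * t ^ 2 + δ * w ^ 2)).1
      (by simpa using h)

/-- A binary form whose reduction is anisotropic has unit discriminant. -/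
theorem norm_discrim_eq_one [ProperSpace K] {β γ : K} (hβ : ‖β‖ ≤ 1) (hγ : ‖γ‖ ≤ 1)
    (h : ∀ s t : K, ‖s‖ ≤ 1 → ‖t‖ ≤ 1 → (‖s‖ = 1 ∨ ‖t‖ = 1) →
      ‖s ^ 2 + β * s * t + γ * t ^ 2‖ = 1) : ‖β ^ 2 - 4 * γ‖ = 1 := by
  have h2 : ‖(2 : K)‖ ≤ 1 := norm_two_le_one
  have h4 : ‖(4 : K)‖ ≤ 1 := by
    rw [show (4 : K) = 2 * 2 by norm_num]; exact norm_mul_le_one_of_le_of_le h2 h2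
  have hle : ‖β ^ 2 - 4 * γ‖ ≤ 1 :=
    norm_sub_le_of_norm_le (by rw [sq]; exact norm_mul_le_one_of_le_of_le hβ hβ)
      (norm_mul_le_one_of_le_of_le h4 hγ)
  refine hle.eq_of_not_lt fun hlt => ?_
  rcases h2.eq_or_lt with h2' | h2'
  · have := h β (-2) hβ (by rwa [norm_neg]) (Or.inr (by rwa [norm_neg]))
    rw [show β ^ 2 + β * β * -2 + γ * (-2) ^ 2 = -(β ^ 2 - 4 * γ) by ring, norm_neg] at this
    exact hlt.ne this
  · have hβ' : ‖β‖ < 1 := by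
      have : ‖β ^ 2‖ < 1 := by
        rw [show β ^ 2 = (β ^ 2 - 4 * γ) + 2 * γ * 2 by ring]
        exact norm_add_lt_of_norm_lt hlt
          (norm_mul_lt_one_of_le_of_lt (norm_mul_le_one_of_le_of_le h2 hγ) h2')
      rw [norm_pow] at this
      exact (pow_lt_one_iff_of_nonneg (norm_nonneg _) two_ne_zero).1 this
    have := (isDiscreteValuationRing_and_finite_residueField (K := K)).2
    lift γ to 𝒪[K] using Valued.integer.mem_iff.2 hγ
    obtain ⟨s, hs⟩ := FiniteField.exists_sq_add_eq_zero_of_char_two (F := 𝓀[K])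
      (by rw [← map_ofNat (IsLocalRing.residue 𝒪[K]),
        (residue_eq_zero_iff_norm_lt_one (2 : 𝒪[K])).2 h2'])
      (IsLocalRing.residue 𝒪[K] γ)
    obtain ⟨s, rfl⟩ := IsLocalRing.residue_surjective s
    have h1 := h s 1 (Valued.integer.norm_le_one s) norm_one.le (Or.inr norm_one)
    have h3 : ‖(s : K) ^ 2 + γ‖ < 1 :=
      (residue_eq_zero_iff_norm_lt_one (s ^ 2 + γ)).1 (by simpa using hs)
    rw [show (s : K) ^ 2 + β * s * 1 + γ * 1 ^ 2 = (s ^ 2 + γ) + s * β by ring] at h1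
    exact (norm_add_lt_of_norm_lt h3 (norm_mul_lt_one_of_le_of_lt
      (Valued.integer.norm_le_one s) hβ')).ne h1

variable {L : Type*} [NontriviallyNormedField L] [IsUltrametricDist L] [NormedAlgebra K L]

theorem exists_ternary_eq_zero_of_even_finrank [ProperSpace K] [ProperSpace L] [CharZero K]
    [FiniteDimensional K L] (hL : Even (Module.finrank K L)) {β γ δ : K} (hβ : ‖β‖ ≤ 1)
    (hγ : ‖γ‖ ≤ 1) (hδ : δ ≠ 0)
    (h : ∀ s t : K, ‖s‖ ≤ 1 → ‖t‖ ≤ 1 → (‖s‖ = 1 ∨ ‖t‖ = 1) →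
      ‖s ^ 2 + β * s * t + γ * t ^ 2‖ = 1) :
    ∃ x y z : L, (x ≠ 0 ∨ y ≠ 0 ∨ z ≠ 0) ∧ x ^ 2 + algebraMap K L β * x * y +
      algebraMap K L γ * y ^ 2 + algebraMap K L δ * z ^ 2 = 0 := by
  have hD := norm_discrim_eq_one hβ hγ h
  have hβ' : ‖algebraMap K L β‖ ≤ 1 := by rwa [norm_algebraMap']
  have hγ' : ‖algebraMap K L γ‖ ≤ 1 := by rwa [norm_algebraMap']
  have hD' : ‖algebraMap K L β ^ 2 - 4 * algebraMap K L γ‖ = 1 := by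
    rw [← hD, ← norm_algebraMap' L (β ^ 2 - 4 * γ), map_sub, map_mul, map_pow,
      map_ofNat]
  obtain ⟨e, hef, π, hπ⟩ := exists_ramificationIdx_mul_finrank_eq (K := K) (L := L)
  rw [← hef, Nat.even_mul] at hL
  rcases hL with he | hf
  · obtain ⟨m, hm⟩ := hπ δ hδ
    obtain ⟨d, rfl⟩ := he
    set μ : L := π ^ (d * m) with hμ
    have hμδ : ‖algebraMap K L δ‖ = ‖μ‖ ^ 2 := by
      rw [norm_algebraMap', hm, hμ, norm_zpow, ← zpow_natCast, ← zpow_mul]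
      congr 1; push_cast; ring
    have hδ' : algebraMap K L δ ≠ 0 := by simpa using hδ
    have hμ0 : μ ≠ 0 := by
      intro h0
      simp [h0, hδ] at hμδ
    obtain ⟨x, y, z, h0, hz⟩ := exists_ternary_eq_zero_of_norm_eq_one hβ' hγ'
      (δ := algebraMap K L δ / μ ^ 2) (by
        rw [norm_div, norm_pow, hμδ, div_self (by positivity)]) hD'
    refine ⟨x, y, z / μ, by simpa [hμ0] using h0, ?_⟩
    rw [← hz]; ring
  · have := (isDiscreteValuationRing_and_finite_residueField (K := L)).2
    lift β to 𝒪[K] using Valued.integer.mem_iff.2 hβ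
    lift γ to 𝒪[K] using Valued.integer.mem_iff.2 hγ
    obtain ⟨t, ht⟩ := FiniteField.exists_root_quadratic_of_even_finrank (E := 𝓀[L]) hf
      (IsLocalRing.residue 𝒪[K] β) (IsLocalRing.residue 𝒪[K] γ)
    obtain ⟨t, rfl⟩ := IsLocalRing.residue_surjective t
    have ht' : IsLocalRing.residue 𝒪[L]
        (t ^ 2 + algebraMap 𝒪[K] 𝒪[L] β * t + algebraMap 𝒪[K] 𝒪[L] γ) = 0 := by
      rw [map_add, map_add, map_mul, map_pow]
      exact ht
    rw [residue_eq_zero_iff_norm_lt_one] at ht'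
    refine exists_ternary_eq_zero_of_norm_lt_one (s := t) (t := 1) (w := 0) hβ' hγ' hD'
      (Valued.integer.norm_le_one t) norm_one.le (Or.inr norm_one) ?_
    simpa [coe_algebraMap_integer] using ht'

end

section

variable {K : Type*} [NontriviallyNormedField K] [IsUltrametricDist K]
variable {V : Type*} [AddCommGroup V] [Module K V] {q : QuadraticForm K V}

theorem quadraticMap_smul_add_smul {R M : Type*} [CommRing R] [AddCommGroup M] [Module R M]
    (q : QuadraticForm R M) (a b : R) (x y : M) :
    q (a • x + b • y) = a ^ 2 * q x + a * b * QuadraticMap.polar q x y + b ^ 2 * q y := by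
  rw [QuadraticMap.map_add q, QuadraticMap.map_smul, QuadraticMap.map_smul,
    QuadraticMap.polar_smul_left, QuadraticMap.polar_smul_right]
  simp only [smul_eq_mul]
  ring

/-- A Cauchy-Schwarz inequality for anisotropic forms. -/
theorem norm_polar_sq_le [ProperSpace K] (hq : q.Anisotropic) (x y : V) :
    ‖QuadraticMap.polar q x y‖ ^ 2 ≤ ‖q x‖ * ‖q y‖ := by
  by_contra! h
  obtain ⟨r, hr⟩ := exists_quadratic_eq_zero_of_norm_lt h
  have h0 : r • x + (1 : K) • y = 0 := hq _ (by
    rw [quadraticMap_smul_add_smul, ← hr]; ring)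
  rw [one_smul] at h0
  obtain rfl : y = -(r • x) := eq_neg_of_add_eq_zero_right h0
  rw [QuadraticMap.polar_neg_right, QuadraticMap.polar_smul_right, QuadraticMap.polar_self,
    QuadraticMap.map_neg, QuadraticMap.map_smul] at h
  simp only [smul_eq_mul, nsmul_eq_mul, Nat.cast_ofNat, norm_neg, norm_mul] at h
  have h2 : ‖(2 : K)‖ ^ 2 ≤ 1 := pow_le_one₀ (norm_nonneg _) norm_two_le_one
  have h3 : 0 ≤ (‖r‖ * ‖q x‖) ^ 2 := by positivity
  nlinarith

theorem norm_map_add_le_max [ProperSpace K] (hq : q.Anisotropic) (x y : V) :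
    ‖q (x + y)‖ ≤ max ‖q x‖ ‖q y‖ := by
  rw [QuadraticMap.map_add q]
  refine norm_add_le_of_norm_le (norm_add_le_of_norm_le (le_max_left _ _) (le_max_right _ _)) ?_
  refine (sq_le_sq₀ (norm_nonneg _) (by positivity)).1 ((norm_polar_sq_le hq x y).trans ?_)
  rw [sq]
  gcongr
  exacts [le_max_left _ _, le_max_right _ _]

theorem norm_map_sub_le_max [ProperSpace K] (hq : q.Anisotropic) (x y : V) :
    ‖q (x - y)‖ ≤ max ‖q x‖ ‖q y‖ := by
  simpa [sub_eq_add_neg] using norm_map_add_le_max hq x (-y)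

theorem exists_forall_norm_map_le [ProperSpace K] (hq : q.Anisotropic) {E : Type*}
    [NormedAddCommGroup E] [ProperSpace E] (x : V) (T : E → V)
    (hT : Continuous fun e => q (x + T e)) {c : ℝ} (hc : 0 < c)
    (hcT : ∀ e, c * ‖e‖ ^ 2 ≤ ‖q (T e)‖) (hT0 : T 0 = 0) :
    ∃ e, ∀ e', ‖q (x + T e)‖ ≤ ‖q (x + T e')‖ := by
  refine hT.norm.exists_forall_le' 0 ?_
  have hlim : Filter.Tendsto (fun e : E => c * ‖e‖ ^ 2) (Filter.cocompact E) Filter.atTop :=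
    ((Filter.tendsto_pow_atTop two_ne_zero).comp tendsto_norm_cocompact_atTop).const_mul_atTop hc
  filter_upwards [hlim.eventually_gt_atTop ‖q x‖] with e he
  have h := norm_map_sub_le_max hq (x + T e) x
  rw [add_sub_cancel_left] at h
  rw [hT0, add_zero]
  exact ((le_max_iff.1 ((he.trans_le (hcT e)).le.trans h)).elim id
    fun _ => (le_max_iff.1 ((hcT e).trans h)).elim he.le.trans fun h' => absurd h' he.not_ge)

omit [IsUltrametricDist K] in
theorem norm_quadraticMap_smul (a : K) (x : V) : ‖q (a • x)‖ = ‖a‖ ^ 2 * ‖q x‖ := by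
  rw [QuadraticMap.map_smul, smul_eq_mul, norm_mul, norm_mul, sq]

theorem norm_map_smul_le [ProperSpace K] (hq : q.Anisotropic) {x y : V}
    (h : ∀ c : K, ‖q x‖ ≤ ‖q (x + c • y)‖) (s t : K) :
    ‖q (s • x)‖ ≤ ‖q (s • x + t • y)‖ ∧ ‖q (t • y)‖ ≤ ‖q (s • x + t • y)‖ := by
  have h1 : ‖q (s • x)‖ ≤ ‖q (s • x + t • y)‖ := by
    rcases eq_or_ne s 0 with rfl | hs
    · simp
    · rw [← mul_inv_cancel_left₀ hs t, mul_smul s (s⁻¹ * t), ← smul_add,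
        norm_quadraticMap_smul, norm_quadraticMap_smul]
      exact mul_le_mul_of_nonneg_left (h _) (by positivity)
  refine ⟨h1, ?_⟩
  have h2 := norm_map_sub_le_max hq (s • x + t • y) (s • x)
  rwa [add_sub_cancel_left, max_eq_left h1] at h2

theorem norm_map_smul_add_smul [ProperSpace K] (hq : q.Anisotropic) {x y : V}
    (hxy : ‖q x‖ = ‖q y‖) (h : ∀ c : K, ‖q x‖ ≤ ‖q (x + c • y)‖) {s t : K}
    (hs : ‖s‖ ≤ 1) (ht : ‖t‖ ≤ 1) (hst : ‖s‖ = 1 ∨ ‖t‖ = 1) :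
    ‖q (s • x + t • y)‖ = ‖q x‖ := by
  have hle := norm_map_smul_le hq h s t
  rw [norm_quadraticMap_smul, norm_quadraticMap_smul] at hle
  refine le_antisymm ((norm_map_add_le_max hq _ _).trans (max_le ?_ ?_)) ?_
  · rw [norm_quadraticMap_smul]
    exact mul_le_of_le_one_left (norm_nonneg _) (pow_le_one₀ (norm_nonneg _) hs)
  · rw [norm_quadraticMap_smul, hxy]
    exact mul_le_of_le_one_left (norm_nonneg _) (pow_le_one₀ (norm_nonneg _) ht)
  · rcases hst with hs | ht
    · simpa [hs] using hle.1
    · simpa [ht, hxy] using hle.2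

/-- An anisotropic form in at least three variables represents, on a suitable plane, a scalar
multiple of a form with anisotropic reduction. -/
theorem exists_norm_map_eq_and_forall_norm_map_le [ProperSpace K] [FiniteDimensional K V]
    (hV : 3 ≤ Module.finrank K V) (hq : q.Anisotropic) :
    ∃ x y : V, x ≠ 0 ∧ ‖q x‖ = ‖q y‖ ∧ ∀ c : K, ‖q x‖ ≤ ‖q (x + c • y)‖ := by
  classical
  have hspan : ∀ s : Finset V, s.card < 3 → ∃ v, v ∉ Submodule.span K (s : Set V) := by
    intro s hs
    refine SetLike.exists_not_mem_of_ne_top _ (fun h => ?_) rfl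
    have := finrank_span_finset_le_card (R := K) s
    rw [Set.finrank, h, finrank_top] at this
    omega
  have hpos : ∀ {v : V}, v ≠ 0 → 0 < ‖q v‖ := fun hv => norm_pos_iff.2 fun h => hv (hq _ h)
  obtain ⟨e₀, he₀⟩ := hspan ∅ (by simp)
  have he₀ : e₀ ≠ 0 := by simpa using he₀
  obtain ⟨u, hu⟩ := hspan {e₀} (by simp)
  obtain ⟨a, ha⟩ := exists_forall_norm_map_le hq u (fun a : K => a • e₀)
    (by
      have : ∀ a : K, q (u + a • e₀) = q ((1 : K) • u + a • e₀) := fun a => by rw [one_smul]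
      simp only [this, quadraticMap_smul_add_smul]
      fun_prop) (hpos he₀) (fun a => by
      rw [norm_quadraticMap_smul, mul_comm])
    (zero_smul _ _)
  set e₁ := u + a • e₀ with he₁
  have he₁0 : e₁ ≠ 0 := by
    intro h
    apply hu
    rw [he₁] at h
    rw [eq_neg_of_add_eq_zero_left h]
    simp [Submodule.mem_span_singleton_self, Submodule.smul_mem]
  have h₁ : ∀ c : K, ‖q e₁‖ ≤ ‖q (e₁ + c • e₀)‖ := fun c => by
    have := ha (a + c)
    rwa [add_smul, ← add_assoc, ← he₁] at this
  have hmax : ∀ c : K × K, min ‖q e₀‖ ‖q e₁‖ * ‖c‖ ^ 2 ≤ ‖q (c.1 • e₀ + c.2 • e₁)‖ := by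
    intro c
    have h := norm_map_smul_le hq h₁ c.2 c.1
    rw [norm_quadraticMap_smul, norm_quadraticMap_smul, add_comm] at h
    rcases max_choice ‖c.1‖ ‖c.2‖ with hc | hc <;> rw [Prod.norm_def, hc, mul_comm]
    · exact le_trans (by gcongr; exact min_le_left _ _) h.2
    · exact le_trans (by gcongr; exact min_le_right _ _) h.1
  obtain ⟨v, hv⟩ := hspan {e₀, e₁} (Finset.card_le_two.trans_lt (by norm_num))
  obtain ⟨b, hb⟩ := exists_forall_norm_map_le hq v (fun b : K × K => b.1 • e₀ + b.2 • e₁)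
    (by
      simp only [QuadraticMap.map_add q v, QuadraticMap.polar_add_right,
        QuadraticMap.polar_smul_right, quadraticMap_smul_add_smul]
      fun_prop) (lt_min (hpos he₀) (hpos he₁0)) hmax (by simp)
  set e₂ := v + (b.1 • e₀ + b.2 • e₁) with he₂
  have he₂0 : e₂ ≠ 0 := by
    intro h
    apply hv
    rw [he₂] at h
    rw [eq_neg_of_add_eq_zero_left h]
    exact neg_mem (add_mem (Submodule.smul_mem _ _ (Submodule.subset_span (by simp)))
      (Submodule.smul_mem _ _ (Submodule.subset_span (by simp))))
  have h₂ : ∀ c d : K, ‖q e₂‖ ≤ ‖q (e₂ + (c • e₀ + d • e₁))‖ := fun c d => by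
    have := hb (b.1 + c, b.2 + d)
    rwa [show v + ((b.1 + c) • e₀ + (b.2 + d) • e₁) = e₂ + (c • e₀ + d • e₁) by
      rw [he₂]; module] at this
  have := (isDiscreteValuationRing_and_finite_residueField (K := K)).1
  obtain ⟨π, hπ⟩ := IsDiscreteValuationRing.exists_irreducible 𝒪[K]
  obtain ⟨m₀, hm₀⟩ := norm_eq_zpow hπ (norm_pos_iff.1 (hpos he₀))
  obtain ⟨m₁, hm₁⟩ := norm_eq_zpow hπ (norm_pos_iff.1 (hpos he₁0))
  obtain ⟨m₂, hm₂⟩ := norm_eq_zpow hπ (norm_pos_iff.1 (hpos he₂0))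
  have hπ0 : ‖(π : K)‖ ≠ 0 := by simpa using hπ.ne_zero
  have key : ∀ (x y : V) (m n : ℤ), x ≠ 0 → ‖q x‖ = ‖(π : K)‖ ^ m → ‖q y‖ = ‖(π : K)‖ ^ n →
      Even (m - n) → (∀ c : K, ‖q x‖ ≤ ‖q (x + c • y)‖) →
      ∃ x y : V, x ≠ 0 ∧ ‖q x‖ = ‖q y‖ ∧ ∀ c : K, ‖q x‖ ≤ ‖q (x + c • y)‖ := by
    rintro x y m n hx hm hn ⟨d, hd⟩ h
    refine ⟨x, (π : K) ^ d • y, hx, ?_, fun c => by rw [smul_smul]; exact h _⟩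
    rw [norm_quadraticMap_smul, norm_zpow, hm, hn, sq, ← zpow_add₀ hπ0, ← zpow_add₀ hπ0, ← hd,
      sub_add_cancel]
  have hpar : Even (m₁ - m₀) ∨ Even (m₂ - m₀) ∨ Even (m₂ - m₁) := by
    simp only [Int.even_sub]; tauto
  rcases hpar with h | h | h
  · exact key _ _ _ _ he₁0 hm₁ hm₀ h h₁
  · exact key _ _ _ _ he₂0 hm₂ hm₀ h fun c => by simpa using h₂ c 0
  · exact key _ _ _ _ he₂0 hm₂ hm₁ h fun c => by simpa using h₂ 0 c

omit [IsUltrametricDist K] in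
theorem exists_ne_zero_polar_eq_zero [FiniteDimensional K V] (hV : 3 ≤ Module.finrank K V)
    (x y : V) :
    ∃ z : V, z ≠ 0 ∧ QuadraticMap.polar q x z = 0 ∧ QuadraticMap.polar q y z = 0 := by
  have h : LinearMap.ker ((q.polarBilin x).prod (q.polarBilin y)) ≠ ⊥ :=
    LinearMap.ker_ne_bot_of_finrank_lt (by simp; omega)
  obtain ⟨z, hz, hz0⟩ := Submodule.exists_mem_ne_zero_of_ne_bot h
  exact ⟨z, hz0, by simpa using hz⟩

variable {L : Type*} [NontriviallyNormedField L] [IsUltrametricDist L] [NormedAlgebra K L]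

/-- The restriction of an anisotropic form to a suitable three-dimensional subspace becomes
isotropic over every extension of even degree. -/
theorem exists_linearIndependent_isotropic [ProperSpace K] [ProperSpace L] [CharZero K]
    [FiniteDimensional K L] (hL : Even (Module.finrank K L)) [FiniteDimensional K V]
    (hV : 3 ≤ Module.finrank K V) (hq : q.Anisotropic) :
    ∃ x y z : V, LinearIndependent K ![x, y, z] ∧ QuadraticMap.polar q x z = 0 ∧
      QuadraticMap.polar q y z = 0 ∧ ∃ a b c : L, (a ≠ 0 ∨ b ≠ 0 ∨ c ≠ 0) ∧
        algebraMap K L (q x) * a ^ 2 + algebraMap K L (QuadraticMap.polar q x y) * a * b +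
          algebraMap K L (q y) * b ^ 2 + algebraMap K L (q z) * c ^ 2 = 0 := by
  obtain ⟨x, y, hx, hxy, h⟩ := exists_norm_map_eq_and_forall_norm_map_le hV hq
  obtain ⟨z, hz, hxz, hyz⟩ := exists_ne_zero_polar_eq_zero (q := q) hV x y
  have hqx : q x ≠ 0 := fun h => hx (hq _ h)
  have hqz : q z ≠ 0 := fun h => hz (hq _ h)
  have hy : y ≠ 0 := by
    rintro rfl
    simp [hqx] at hxy
  refine ⟨x, y, z, ?_, hxz, hyz, ?_⟩
  · rw [Fintype.linearIndependent_iff]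
    intro g hg
    simp only [Fin.sum_univ_three, Matrix.cons_val_zero, Matrix.cons_val_one, Matrix.cons_val] at hg
    have h2 : g 2 = 0 := by
      have := congrArg (fun v => QuadraticMap.polar q v z) hg
      simpa [QuadraticMap.polar_add_left, QuadraticMap.polar_smul_left, hxz, hyz,
        QuadraticMap.polar_self, hqz] using this
    rw [h2, zero_smul, add_zero] at hg
    have h0 : g 0 = 0 := by
      by_contra h0
      have := h ((g 0)⁻¹ * g 1)
      have e : x + ((g 0)⁻¹ * g 1) • y = (g 0)⁻¹ • (g 0 • x + g 1 • y) := by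
        rw [smul_add, smul_smul, smul_smul, inv_mul_cancel₀ h0, one_smul]
      rw [e, hg, smul_zero, QuadraticMap.map_zero, norm_zero] at this
      exact hqx (norm_le_zero_iff.1 this)
    have h1 : g 1 = 0 := by simpa [h0, hy] using hg
    intro i
    fin_cases i <;> assumption
  · have hβ : ‖QuadraticMap.polar q x y / q x‖ ≤ 1 := by
      rw [norm_div]
      refine div_le_one_of_le₀ ((sq_le_sq₀ (norm_nonneg _) (norm_nonneg _)).1
        ((norm_polar_sq_le hq x y).trans ?_)) (norm_nonneg _)
      rw [← hxy, sq]
    have hγ : ‖q y / q x‖ ≤ 1 := by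
      rw [norm_div, hxy]
      exact div_self_le_one _
    obtain ⟨a, b, c, h0, habc⟩ := exists_ternary_eq_zero_of_even_finrank (L := L) hL hβ hγ
      (div_ne_zero hqz hqx) fun s t hs ht hst => by
        have e : s ^ 2 + QuadraticMap.polar q x y / q x * s * t + q y / q x * t ^ 2 =
            q (s • x + t • y) / q x := by
          rw [quadraticMap_smul_add_smul]
          field_simp
        rw [e, norm_div, norm_map_smul_add_smul hq hxy h hs ht hst,
          div_self (norm_ne_zero_iff.2 hqx)]
    refine ⟨a, b, c, h0, ?_⟩
    have hqx' : algebraMap K L (q x) ≠ 0 := by simpa using hqx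
    rw [← mul_zero (algebraMap K L (q x)), ← habc]
    simp only [map_div₀]
    field_simp

end

theorem tmul_ne_zero_of_linearIndependent {K L V : Type*} [Field K] [Field L] [Algebra K L]
    [AddCommGroup V] [Module K V] {x y z : V} (h : LinearIndependent K ![x, y, z]) {a b c : L}
    (habc : a ≠ 0 ∨ b ≠ 0 ∨ c ≠ 0) : a ⊗ₜ[K] x + b ⊗ₜ[K] y + c ⊗ₜ[K] z ≠ 0 := by
  obtain ⟨g, hg⟩ := (Fintype.linearCombination K ![x, y, z]).exists_leftInverse_of_injective
    (LinearMap.ker_eq_bot.2 h.fintypeLinearCombination_injective)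
  have hgi : ∀ i, g (![x, y, z] i) = Pi.single i 1 := fun i => by
    simpa [Fintype.linearCombination_apply_single] using LinearMap.congr_fun hg (Pi.single i 1)
  have hgx : g x = Pi.single 0 1 := hgi 0
  have hgy : g y = Pi.single 1 1 := hgi 1
  have hgz : g z = Pi.single 2 1 := hgi 2
  intro h0
  have h1 : ∀ i, g x i • a + g y i • b + g z i • c = 0 := fun i => by
    simpa using congrArg (fun v => TensorProduct.rid K L
      (LinearMap.lTensor L (LinearMap.proj i ∘ₗ g) v)) h0
  rw [hgx, hgy, hgz] at h1
  have ha := h1 0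
  have hb := h1 1
  have hc := h1 2
  simp at ha hb hc
  simp [ha, hb, hc] at habc

theorem quadraticForm_baseChange_tmul_add_tmul_add_tmul {K L V : Type*} [Field K] [Field L]
    [Algebra K L] [AddCommGroup V] [Module K V] [Invertible (2 : K)]
    (q : QuadraticForm K V) {x y z : V}
    (hxz : QuadraticMap.polar q x z = 0) (hyz : QuadraticMap.polar q y z = 0) (a b c : L) :
    QuadraticForm.baseChange L q (a ⊗ₜ[K] x + b ⊗ₜ[K] y + c ⊗ₜ[K] z) =
      algebraMap K L (q x) * a ^ 2 + algebraMap K L (QuadraticMap.polar q x y) * a * b +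
          algebraMap K L (q y) * b ^ 2 + algebraMap K L (q z) * c ^ 2 := by
  have hp : ∀ (a b : L) (x y : V), QuadraticMap.polar (QuadraticForm.baseChange L q)
      (a ⊗ₜ[K] x) (b ⊗ₜ[K] y) = algebraMap K L (QuadraticMap.polar q x y) * a * b := by
    intro a b x y
    have : Invertible (2 : L) := (Invertible.map (algebraMap K L) 2).copy _ (map_ofNat _ 2).symm
    have := congrArg (fun B : LinearMap.BilinForm L (L ⊗[K] V) => B (a ⊗ₜ[K] x) (b ⊗ₜ[K] y))
      (QuadraticForm.polarBilin_baseChange (R := K) (A := L) q)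
    simpa [Algebra.smul_def, mul_assoc, mul_comm a b] using this
  rw [QuadraticMap.map_add (QuadraticForm.baseChange L q),
    QuadraticMap.map_add (QuadraticForm.baseChange L q), QuadraticMap.polar_add_left, hp, hp, hp,
    hxz, hyz]
  simp only [QuadraticForm.baseChange_tmul, Algebra.smul_def]
  simp
  ring

theorem IsUltrametricDist.of_spectralNorm (K L : Type*) [NontriviallyNormedField K]
    [CompleteSpace K] [IsUltrametricDist K] [Field L] [Algebra K L] [Algebra.IsAlgebraic K L] :
    letI := spectralNorm.nontriviallyNormedField K L
    IsUltrametricDist L := by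
  let := spectralNorm.nontriviallyNormedField K L
  exact IsUltrametricDist.isUltrametricDist_of_isNonarchimedean_norm
    (isNonarchimedean_spectralNorm (K := K) (L := L))

theorem exists_linearIndependent_isotropic_of_padic (p : ℕ) [Fact p.Prime]
    (k : Type*) [Field k] [Algebra ℚ_[p] k] [FiniteDimensional ℚ_[p] k]
    {V : Type*} [AddCommGroup V] [Module k V] [FiniteDimensional k V]
    (hV : 3 ≤ Module.finrank k V) {q : QuadraticForm k V} (hq : q.Anisotropic)
    (l : Type*) [Field l] [Algebra k l] [FiniteDimensional k l]
    (hl : Even (Module.finrank k l)) :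
    ∃ x y z : V, LinearIndependent k ![x, y, z] ∧ QuadraticMap.polar q x z = 0 ∧
      QuadraticMap.polar q y z = 0 ∧ ∃ a b c : l, (a ≠ 0 ∨ b ≠ 0 ∨ c ≠ 0) ∧
        algebraMap k l (q x) * a ^ 2 + algebraMap k l (QuadraticMap.polar q x y) * a * b +
          algebraMap k l (q y) * b ^ 2 + algebraMap k l (q z) * c ^ 2 = 0 := by
  have : CharZero k := charZero_of_injective_algebraMap (algebraMap ℚ_[p] k).injective
  let : Algebra ℚ_[p] l := ((algebraMap k l).comp (algebraMap ℚ_[p] k)).toAlgebra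
  have : IsScalarTower ℚ_[p] k l := .of_algebraMap_eq fun _ => rfl
  have : FiniteDimensional ℚ_[p] l := .trans ℚ_[p] k l
  have := IsUltrametricDist.of_spectralNorm ℚ_[p] k
  have := IsUltrametricDist.of_spectralNorm ℚ_[p] l
  let := spectralNorm.nontriviallyNormedField ℚ_[p] k
  let := spectralNorm.nontriviallyNormedField ℚ_[p] l
  let := spectralNorm.normedAlgebra ℚ_[p] k
  let := spectralNorm.normedAlgebra ℚ_[p] l
  let : NormedAlgebra k l := spectralNorm.normedAlgebra' ℚ_[p] k l
  have : ProperSpace k := FiniteDimensional.proper ℚ_[p] k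
  have : ProperSpace l := FiniteDimensional.proper ℚ_[p] l
  exact exists_linearIndependent_isotropic hl hV hq

end

/-- Let `k` be a `p`-adic field and `q` a quadratic form of rank `≥ 3`
over `k` with nondegenerate polar form. Then `q` becomes isotropic over every finite
field extension of `k` of even degree. -/
theorem quadraticForm_isotropic_of_even_degree_extension
    (p : ℕ) [Fact p.Prime]
    (k : Type) [Field k] [Algebra ℚ_[p] k] [FiniteDimensional ℚ_[p] k]
    (V : Type) [AddCommGroup V] [Module k V] [FiniteDimensional k V]
    (hV : 3 ≤ Module.finrank k V)
    (q : QuadraticForm k V)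
    (hq : q.polarBilin.Nondegenerate)
    (l : Type) [Field l] [Algebra k l] [FiniteDimensional k l]
    (hl : Even (Module.finrank k l)) :
    ∃ v : l ⊗[k] V, v ≠ 0 ∧ QuadraticFormPadic.baseChange p k V l q v = 0 := by
  have : CharZero k := charZero_of_injective_algebraMap (algebraMap ℚ_[p] k).injective
  let : Invertible (2 : k) := invertibleOfNonzero two_ne_zero
  change ∃ v : l ⊗[k] V, v ≠ 0 ∧ QuadraticForm.baseChange l q v = 0
  by_cases h : q.Anisotropic
  · obtain ⟨x, y, z, hxyz, hxz, hyz, a, b, c, habc, h0⟩ :=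
      exists_linearIndependent_isotropic_of_padic p k hV h l hl
    exact ⟨_, tmul_ne_zero_of_linearIndependent hxyz habc,
      (quadraticForm_baseChange_tmul_add_tmul_add_tmul q hxz hyz a b c).trans h0⟩
  · obtain ⟨x, hx, hx0⟩ : ∃ x, q x = 0 ∧ x ≠ 0 := by
      simpa [QuadraticMap.Anisotropic] using h
    refine ⟨1 ⊗ₜ x, fun h1 => hx0 ?_, by simp [hx]⟩
    exact Module.FaithfullyFlat.tensorProduct_mk_injective (A := k) (B := l) V
      (by simpa using h1)
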